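/- Let u be the m-bonacci word for an integer m ≥ 2. Then for every n ≥ 1 and every letter ℓ ∈ {0,1,…,m−1}, the word ℓ·u_[n−1] (the letter ℓ followed by the prefix of u of length n−1) is a factor of u. -/

import Mathlib

/-- The m-bonacci substitution on letters. -/
def mbSub (m : ℕ) (ℓ : ℕ) : List ℕ :=
  if ℓ = m - 1 then [0] else [0, ℓ + 1]

/-- Application of the m-bonacci substitution to a word. -/
def mbApply (m : ℕ) (w : List ℕ) : List ℕ := w.flatMap (mbSub m)

/-- σ_m^k(0). -/
def mbIter (m k : ℕ) : List ℕ := (mbApply m)^[k] [0]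

/-- w is a factor of the m-bonacci word. -/
def mbFactor (m : ℕ) (w : List ℕ) : Prop := ∃ k, w <:+: mbIter m k

/-- The prefix of length n of the m-bonacci word. -/
def mbPrefix (m n : ℕ) : List ℕ := (mbIter m n).take n

/-- Abelian complexity: number of distinct Parikh vectors of factors of length n. -/
noncomputable def mbAC (m n : ℕ) : ℕ :=
  Set.ncard ((fun (w : List ℕ) (ℓ : ℕ) => w.count ℓ) ''
    {w : List ℕ | mbFactor m w ∧ w.length = n})

/-- Tribonacci numbers. -/
def tribN : ℕ → ℕ
  | 0 => 0
  | 1 => 0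
  | 2 => 1
  | n + 3 => tribN (n + 2) + tribN (n + 1) + tribN n

/-- Value of a digit string (most significant digit first) in the Tribonacci system. -/
def valT : List ℕ → ℕ
  | [] => 0
  | d :: rest => d * tribN (rest.length + 3) + valT rest

/-- L is the normal T-representation of n (MSB first, greedy). -/
def IsNormalTRep (n : ℕ) (L : List ℕ) : Prop :=
  (∀ d ∈ L, d ≤ 1) ∧ (∀ d ∈ L.take 1, d = 1) ∧ valT L = n ∧
    ∀ S, S <:+ L → valT S < tribN (S.length + 3)

/-- Value of a digit string (MSB first) in the m-bonacci numeration system U_j = |σ_m^j(0)|. -/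
def valU (m : ℕ) : List ℕ → ℕ
  | [] => 0
  | d :: rest => d * (mbIter m rest.length).length + valU m rest

/-- L is the normal U-representation of n (MSB first, greedy) in the m-bonacci system. -/
def IsNormalURep (m n : ℕ) (L : List ℕ) : Prop :=
  (∀ d ∈ L, d ≤ 1) ∧ (∀ d ∈ L.take 1, d = 1) ∧ valU m L = n ∧
    ∀ S, S <:+ L → valU m S < (mbIter m S.length).length

theorem mbApply_append (m : ℕ) (v w : List ℕ) :
    mbApply m (v ++ w) = mbApply m v ++ mbApply m w := by
  simp [mbApply]

theorem mbIter_succ (m k : ℕ) : mbIter m (k + 1) = mbApply m (mbIter m k) :=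
  Function.iterate_succ_apply' _ _ _

theorem mbFactor.of_infix {m : ℕ} {v w : List ℕ} (hw : mbFactor m w) (h : v <:+: w) :
    mbFactor m v :=
  hw.imp fun _ hk => h.trans hk

theorem mbFactor.apply {m : ℕ} {w : List ℕ} (hw : mbFactor m w) : mbFactor m (mbApply m w) := by
  obtain ⟨k, s, t, hk⟩ := hw
  refine ⟨k + 1, mbApply m s, mbApply m t, ?_⟩
  rw [mbIter_succ, ← hk, mbApply_append, mbApply_append]

theorem mbFactor.cons_succ {m ℓ : ℕ} {w : List ℕ} (hℓ : ℓ + 1 < m) (h : mbFactor m (ℓ :: w)) :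
    mbFactor m ((ℓ + 1) :: mbApply m w) := by
  refine h.apply.of_infix ⟨[0], [], ?_⟩
  have hne : ℓ ≠ m - 1 := by omega
  simp [mbApply, mbSub, hne]

theorem mbFactor.cons_zero {m : ℕ} {w : List ℕ} (h : mbFactor m ((m - 1) :: w)) :
    mbFactor m (0 :: mbApply m w) := by
  refine h.apply.of_infix ⟨[], [], ?_⟩
  simp [mbApply, mbSub]

theorem zero_prefix_mbApply_zero (m : ℕ) : [0] <+: mbApply m [0] := by
  by_cases h : 0 = m - 1 <;> simp [mbApply, mbSub, h]

theorem mbFactor_one_zero {m : ℕ} (hm : 2 ≤ m) : mbFactor m [1, 0] := by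
  refine ⟨2, ?_⟩
  have h0 : 0 ≠ m - 1 := by omega
  by_cases h1 : 1 = m - 1
  · exact ⟨[0], [], by simp [mbIter, mbApply, mbSub, ← h1]⟩
  · exact ⟨[0], [2], by simp [mbIter, mbApply, mbSub, h0, h1]⟩

theorem mbFactor_succ_zero {m : ℕ} (hm : 2 ≤ m) (ℓ : ℕ) (hℓ : ℓ + 1 < m) :
    mbFactor m [ℓ + 1, 0] := by
  induction ℓ with
  | zero => exact mbFactor_one_zero hm
  | succ ℓ ih =>
    exact ((ih (by omega)).cons_succ hℓ).of_infix
      ((List.prefix_cons_inj _).2 (zero_prefix_mbApply_zero m)).isInfix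

theorem mbFactor_letter_zero {m : ℕ} (hm : 2 ≤ m) (ℓ : ℕ) (hℓ : ℓ < m) :
    mbFactor m [ℓ, 0] := by
  cases ℓ with
  | succ ℓ => exact mbFactor_succ_zero hm ℓ hℓ
  | zero =>
    have h := mbFactor_succ_zero hm (m - 2) (by omega)
    rw [show m - 2 + 1 = m - 1 by omega] at h
    exact h.cons_zero.of_infix
      ((List.prefix_cons_inj _).2 (zero_prefix_mbApply_zero m)).isInfix

theorem mbFactor_letter_mbIter {m : ℕ} (hm : 2 ≤ m) (k ℓ : ℕ) (hℓ : ℓ < m) :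
    mbFactor m (ℓ :: mbIter m k) := by
  induction k generalizing ℓ with
  | zero => exact mbFactor_letter_zero hm ℓ hℓ
  | succ k ih =>
    rw [mbIter_succ]
    cases ℓ with
    | zero => exact (ih (m - 1) (by omega)).cons_zero
    | succ ℓ => exact (ih ℓ (by omega)).cons_succ hℓ

theorem mbonacci_letter_prefix_factor (m : ℕ) (hm : 2 ≤ m) (n : ℕ) (hn : 1 ≤ n)
    (ℓ : ℕ) (hℓ : ℓ < m) :
    mbFactor m (ℓ :: mbPrefix m (n - 1)) := by
  exact (mbFactor_letter_mbIter hm (n - 1) ℓ hℓ).of_infix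
    ((List.prefix_cons_inj _).2 (List.take_prefix _ _)).isInfix
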